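/- (Dual capacity upper bound for directed information) Let (X^n, Y^n) be jointly distributed random sequences with finite alphabets 𝒳, 𝒴, joint pmf P, and let T be any pmf on 𝒴^n (a test distribution). For a sequence of deterministic functions f = (f_1,…,f_n) with f_i : 𝒴^{i-1} → 𝒳 that is compatible with P (i.e., at each step the prescribed input has positive causally conditioned probability: P(x_i = f_i(y^{i-1}) | x^{i-1}, y^{i-1}) > 0 along every output sequence, where x^{i-1} is determined recursively by f and y^{i-2}), define the induced output pmf P^f_{Y^n}(y^n) := ∏_{i=1}^n P(y_i | y^{i-1}, x^i) with x_j = f_j(y^{j-1}) for j ≤ i. Then I(X^n→Y^n) ≤ max over compatible f of D(P^f_{Y^n} ‖ T). -/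

import Mathlib

open Finset

noncomputable section

-- Probability of the event `E` under the pmf `p` on a finite sample space `Ω`.
open Classical in
def pr {Ω : Type*} [Fintype Ω] (p : Ω → ℝ) (E : Ω → Prop) : ℝ :=
  ∑ ω, if E ω then p ω else 0

-- Shannon entropy `H(U)` (pointwise form).
def entropy {Ω α : Type*} [Fintype Ω] (p : Ω → ℝ) (U : Ω → α) : ℝ :=
  -∑ ω, p ω * Real.log (pr p (fun ω' => U ω' = U ω))

-- Conditional Shannon entropy `H(U | V)`.
def condEntropy {Ω α β : Type*} [Fintype Ω] (p : Ω → ℝ) (U : Ω → α) (V : Ω → β) : ℝ :=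
  -∑ ω, p ω * Real.log
      (pr p (fun ω' => U ω' = U ω ∧ V ω' = V ω) / pr p (fun ω' => V ω' = V ω))

-- Mutual information `I(U ; V)`.
def mutualInfo {Ω α β : Type*} [Fintype Ω] (p : Ω → ℝ) (U : Ω → α) (V : Ω → β) : ℝ :=
  ∑ ω, p ω * Real.log
      (pr p (fun ω' => U ω' = U ω ∧ V ω' = V ω) /
        (pr p (fun ω' => U ω' = U ω) * pr p (fun ω' => V ω' = V ω)))

-- Conditional mutual information `I(U ; V | W)`.
def condMutualInfo {Ω α β γ : Type*} [Fintype Ω] (p : Ω → ℝ)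
    (U : Ω → α) (V : Ω → β) (W : Ω → γ) : ℝ :=
  ∑ ω, p ω * Real.log
      ((pr p (fun ω' => U ω' = U ω ∧ V ω' = V ω ∧ W ω' = W ω) *
          pr p (fun ω' => W ω' = W ω)) /
        (pr p (fun ω' => U ω' = U ω ∧ W ω' = W ω) *
          pr p (fun ω' => V ω' = V ω ∧ W ω' = W ω)))

-- The prefix `(X_0, …, X_{i-1})` of a random sequence `X`.
def prefixSeq {Ω 𝒳 : Type*} (X : Ω → ℕ → 𝒳) (i : ℕ) : Ω → (Fin i → 𝒳) :=
  fun ω j => X ω (j : ℕ)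

-- Directed information `I(X^n → Y^n) = ∑_{i=1}^n I(X^i ; Y_i | Y^{i-1})` (0-indexed).
def directedInfo {Ω 𝒳 𝒴 : Type*} [Fintype Ω] (p : Ω → ℝ)
    (X : Ω → ℕ → 𝒳) (Y : Ω → ℕ → 𝒴) (n : ℕ) : ℝ :=
  ∑ i ∈ Finset.range n,
    condMutualInfo p (prefixSeq X (i + 1)) (fun ω => Y ω i) (prefixSeq Y i)

-- Extension of a length-`n` tuple to an infinite sequence (junk beyond `n`).
def extSeq {𝒴 : Type*} [Nonempty 𝒴] {n : ℕ} (b : Fin n → 𝒴) : ℕ → 𝒴 :=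
  fun i => if h : i < n then b ⟨i, h⟩ else Classical.arbitrary 𝒴

-- The output pmf `P^f(y^n) = ∏_{i=1}^n P(y_i | y^{i-1}, x^i)` induced by the
-- deterministic input strategy `f`, with `x_j = f_j(y^{j-1})`.
def inducedOutput {Ω 𝒳 𝒴 : Type*} [Fintype Ω] [Nonempty 𝒴] (p : Ω → ℝ)
    (X : Ω → ℕ → 𝒳) (Y : Ω → ℕ → 𝒴) (n : ℕ)
    (f : (i : ℕ) → (Fin i → 𝒴) → 𝒳) (b : Fin n → 𝒴) : ℝ :=
  ∏ i ∈ Finset.range n,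
    pr p (fun ω => (∀ j < i + 1, X ω j = f j (fun k : Fin j => extSeq b (k : ℕ))) ∧
          ∀ j < i + 1, Y ω j = extSeq b j) /
      pr p (fun ω => (∀ j < i + 1, X ω j = f j (fun k : Fin j => extSeq b (k : ℕ))) ∧
          ∀ j < i, Y ω j = extSeq b j)

-- `f` is compatible with `P`: at each step, along every output sequence, the
-- prescribed input has positive causally conditioned probability (whenever the
-- conditioning event has positive probability).
def compatible {Ω 𝒳 𝒴 : Type*} [Fintype Ω] (p : Ω → ℝ)
    (X : Ω → ℕ → 𝒳) (Y : Ω → ℕ → 𝒴) (n : ℕ)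
    (f : (i : ℕ) → (Fin i → 𝒴) → 𝒳) : Prop :=
  ∀ (b : ℕ → 𝒴), ∀ i < n,
    0 < pr p (fun ω => (∀ j < i, X ω j = f j (fun k : Fin j => b (k : ℕ))) ∧
          ∀ j < i, Y ω j = b j) →
      0 < pr p (fun ω => (∀ j < i + 1, X ω j = f j (fun k : Fin j => b (k : ℕ))) ∧
          ∀ j < i, Y ω j = b j)

-- Kullback–Leibler divergence between pmfs on a finite set, `⊤` when absolute
-- continuity fails.
open Classical in
def klDivFin {β : Type*} [Fintype β] (q t : β → ℝ) : EReal :=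
  if ∀ b, t b = 0 → q b = 0 then ((∑ b, q b * Real.log (q b / t b) : ℝ) : EReal)
  else ⊤

section aux
variable {Ω 𝒳 𝒴 : Type*} [Fintype Ω]

lemma pr_congr' (p : Ω → ℝ) {E F : Ω → Prop} (h : ∀ ω, E ω ↔ F ω) : pr p E = pr p F := by
  have : E = F := funext fun ω => propext (h ω)
  rw [this]

lemma pr_nonneg' {p : Ω → ℝ} (hp0 : ∀ ω, 0 ≤ p ω) (E : Ω → Prop) : 0 ≤ pr p E := by
  classical
  unfold pr
  apply Finset.sum_nonneg
  intro ω _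
  split_ifs
  · exact hp0 ω
  · exact le_rfl

lemma pr_pos_of_mem {p : Ω → ℝ} (hp0 : ∀ ω, 0 ≤ p ω) {E : Ω → Prop} {ω : Ω} (hω : 0 < p ω)
    (h : E ω) : 0 < pr p E := by
  classical
  unfold pr
  apply Finset.sum_pos'
  · intro ω _
    split_ifs
    · exact hp0 ω
    · exact le_rfl
  · exact ⟨ω, Finset.mem_univ _, by simpa [h] using hω⟩

lemma zero_of_pr_zero {p : Ω → ℝ} (hp0 : ∀ ω, 0 ≤ p ω) {E : Ω → Prop} (h0 : pr p E = 0)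
    {ω : Ω} (h : E ω) : p ω = 0 := by
  by_contra hne
  have := pr_pos_of_mem hp0 (lt_of_le_of_ne (hp0 ω) (Ne.symm hne)) h
  linarith

lemma pr_mul_const (p g : Ω → ℝ) (E : Ω → Prop) (c : ℝ) (h : ∀ ω, E ω → g ω = c) :
    pr (fun ω => p ω * g ω) E = pr p E * c := by
  classical
  unfold pr
  rw [Finset.sum_mul]
  apply Finset.sum_congr rfl
  intro ω _
  split_ifs with hE
  · simp only [h ω hE]
  · simp

lemma pr_mul_zero {p : Ω → ℝ} (hp0 : ∀ ω, 0 ≤ p ω) (g : Ω → ℝ) {E : Ω → Prop}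
    (h0 : pr p E = 0) : pr (fun ω => p ω * g ω) E = 0 := by
  classical
  unfold pr
  apply Finset.sum_eq_zero
  intro ω _
  split_ifs with hE
  · simp only [zero_of_pr_zero hp0 h0 hE, zero_mul]
  · rfl

lemma sum_pr_split [Fintype 𝒳] (q : Ω → ℝ) (E : Ω → Prop) (Z : Ω → 𝒳) :
    ∑ x, pr q (fun ω => E ω ∧ Z ω = x) = pr q E := by
  classical
  unfold pr
  rw [Finset.sum_comm]
  apply Finset.sum_congr rfl
  intro ω _
  by_cases hE : E ω
  · simp [hE]
  · simp [hE]

lemma exists_good [Fintype 𝒳] {p : Ω → ℝ} (hp0 : ∀ ω, 0 ≤ p ω) (g : Ω → ℝ) (E : Ω → Prop)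
    (Z : Ω → 𝒳) (hE : 0 < pr p E) :
    ∃ x, 0 < pr p (fun ω => E ω ∧ Z ω = x) ∧
      pr (fun ω => p ω * g ω) E / pr p E ≤
        pr (fun ω => p ω * g ω) (fun ω => E ω ∧ Z ω = x) / pr p (fun ω => E ω ∧ Z ω = x) := by
  by_contra hcon
  push Not at hcon
  set r := pr (fun ω => p ω * g ω) E / pr p E with hr
  have hle : ∀ x, pr (fun ω => p ω * g ω) (fun ω => E ω ∧ Z ω = x) ≤
      r * pr p (fun ω => E ω ∧ Z ω = x) := by
    intro x
    rcases (pr_nonneg' hp0 (fun ω => E ω ∧ Z ω = x)).eq_or_lt with h | h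
    · rw [pr_mul_zero hp0 g h.symm, ← h, mul_zero]
    · have := hcon x h
      rw [div_lt_iff₀ h] at this
      exact this.le
  have hex : ∃ x, 0 < pr p (fun ω => E ω ∧ Z ω = x) := by
    by_contra hno
    push Not at hno
    have : pr p E ≤ 0 := by
      rw [← sum_pr_split p E Z]
      exact Finset.sum_nonpos fun x _ => hno x
    linarith
  obtain ⟨x, hx⟩ := hex
  have hlt : ∑ x, pr (fun ω => p ω * g ω) (fun ω => E ω ∧ Z ω = x) <
      ∑ x, r * pr p (fun ω => E ω ∧ Z ω = x) := by
    apply Finset.sum_lt_sum (fun x _ => hle x)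
    refine ⟨x, Finset.mem_univ _, ?_⟩
    have := hcon x hx
    rwa [div_lt_iff₀ hx] at this
  rw [← Finset.mul_sum, sum_pr_split, sum_pr_split, hr, div_mul_cancel₀ _ hE.ne'] at hlt
  exact lt_irrefl _ hlt

def strat (s : (i : ℕ) → (Fin i → 𝒳) → (Fin i → 𝒴) → 𝒳) : (i : ℕ) → (Fin i → 𝒴) → 𝒳
  | i, y => s i (fun j => strat s j (fun k => y ⟨k, k.2.trans j.2⟩)) y
termination_by i => i
decreasing_by exact j.2

-- history events
def evA (X : Ω → ℕ → 𝒳) (Y : Ω → ℕ → 𝒴) (f : (i : ℕ) → (Fin i → 𝒴) → 𝒳) (b : ℕ → 𝒴)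
    (i k : ℕ) (ω : Ω) : Prop :=
  (∀ j < i, X ω j = f j (fun k : Fin j => b (k : ℕ))) ∧ ∀ j < k, Y ω j = b j

lemma evA_congr (X : Ω → ℕ → 𝒳) (Y : Ω → ℕ → 𝒴) (f : (i : ℕ) → (Fin i → 𝒴) → 𝒳)
    {b b' : ℕ → 𝒴} {i k : ℕ} (hik : i ≤ k + 1) (h : ∀ j < k, b j = b' j) (ω : Ω) :
    evA X Y f b i k ω ↔ evA X Y f b' i k ω := by
  unfold evA
  refine and_congr ?_ ?_
  · refine forall₂_congr fun j hj => ?_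
    have : (fun k : Fin j => b (k : ℕ)) = (fun k : Fin j => b' (k : ℕ)) := by
      funext l
      exact h l (by have := l.2; omega)
    rw [this]
  · refine forall₂_congr fun j hj => ?_
    rw [h j hj]

lemma exists_strat [Fintype 𝒳] [Nonempty 𝒳] {p : Ω → ℝ} (hp0 : ∀ ω, 0 ≤ p ω) (g : Ω → ℝ)
    (X : Ω → ℕ → 𝒳) (Y : Ω → ℕ → 𝒴) :
    ∃ f : (i : ℕ) → (Fin i → 𝒴) → 𝒳, ∀ (b : ℕ → 𝒴) (i : ℕ), 0 < pr p (evA X Y f b i i) →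
      0 < pr p (evA X Y f b (i + 1) i) ∧
      pr (fun ω => p ω * g ω) (evA X Y f b i i) / pr p (evA X Y f b i i) ≤
        pr (fun ω => p ω * g ω) (evA X Y f b (i + 1) i) / pr p (evA X Y f b (i + 1) i) := by
  have key : ∀ (i : ℕ) (xs : Fin i → 𝒳) (ys : Fin i → 𝒴), ∃ x,
      0 < pr p (fun ω => (∀ j : Fin i, X ω j = xs j) ∧ (∀ j : Fin i, Y ω j = ys j)) →
      0 < pr p (fun ω => ((∀ j : Fin i, X ω j = xs j) ∧ (∀ j : Fin i, Y ω j = ys j)) ∧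
          X ω i = x) ∧
      pr (fun ω => p ω * g ω)
          (fun ω => (∀ j : Fin i, X ω j = xs j) ∧ (∀ j : Fin i, Y ω j = ys j)) /
        pr p (fun ω => (∀ j : Fin i, X ω j = xs j) ∧ (∀ j : Fin i, Y ω j = ys j)) ≤
      pr (fun ω => p ω * g ω)
          (fun ω => ((∀ j : Fin i, X ω j = xs j) ∧ (∀ j : Fin i, Y ω j = ys j)) ∧ X ω i = x) /
        pr p (fun ω => ((∀ j : Fin i, X ω j = xs j) ∧ (∀ j : Fin i, Y ω j = ys j)) ∧
          X ω i = x) := by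
    intro i xs ys
    by_cases h : 0 < pr p (fun ω => (∀ j : Fin i, X ω j = xs j) ∧ (∀ j : Fin i, Y ω j = ys j))
    · obtain ⟨x, hx⟩ := exists_good hp0 g _ (fun ω => X ω i) h
      exact ⟨x, fun _ => hx⟩
    · exact ⟨Classical.arbitrary 𝒳, fun h' => absurd h' h⟩
  choose s hs using key
  refine ⟨strat s, fun b i => ?_⟩
  have h := hs i (fun j => strat s j (fun k => b k)) (fun j => b j)
  have eA : (fun ω => (∀ j : Fin i, X ω j = strat s j (fun k => b k)) ∧
      (∀ j : Fin i, Y ω j = b j)) = evA X Y (strat s) b i i := by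
    funext ω
    simp only [evA, Fin.forall_iff]
  have eB : (fun ω => ((∀ j : Fin i, X ω j = strat s j (fun k => b k)) ∧
      (∀ j : Fin i, Y ω j = b j)) ∧
      X ω i = s i (fun j => strat s j (fun k => b k)) (fun j => b j)) =
      evA X Y (strat s) b (i + 1) i := by
    funext ω
    have hst : strat s i (fun k : Fin i => b k) =
        s i (fun j => strat s j (fun k => b k)) (fun j => b j) := by
      rw [strat]
    simp only [evA, Fin.forall_iff, Nat.lt_succ_iff_lt_or_eq, or_imp, forall_and, forall_eq,
      eq_iff_iff, hst]
    tauto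
  rw [eB, eA] at h
  exact h

lemma inducedOutput_eq [Nonempty 𝒴] (p : Ω → ℝ) (X : Ω → ℕ → 𝒳) (Y : Ω → ℕ → 𝒴) (n : ℕ)
    (f : (i : ℕ) → (Fin i → 𝒴) → 𝒳) (b : Fin n → 𝒴) :
    inducedOutput p X Y n f b = ∏ i ∈ Finset.range n,
      pr p (evA X Y f (extSeq b) (i + 1) (i + 1)) / pr p (evA X Y f (extSeq b) (i + 1) i) := rfl

lemma extSeq_snoc_lt [Nonempty 𝒴] {n : ℕ} (b : Fin n → 𝒴) (y : 𝒴) (j : ℕ) (hj : j < n) :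
    extSeq (Fin.snoc b y : Fin (n + 1) → 𝒴) j = extSeq b j := by
  simp [extSeq, hj, Nat.lt_succ_of_lt hj, Fin.snoc]

lemma extSeq_snoc_eq [Nonempty 𝒴] {n : ℕ} (b : Fin n → 𝒴) (y : 𝒴) :
    extSeq (Fin.snoc b y : Fin (n + 1) → 𝒴) n = y := by
  simp [extSeq, Fin.snoc]

lemma inducedOutput_snoc [Nonempty 𝒴] (p : Ω → ℝ) (X : Ω → ℕ → 𝒳) (Y : Ω → ℕ → 𝒴) (n : ℕ)
    (f : (i : ℕ) → (Fin i → 𝒴) → 𝒳) (b : Fin n → 𝒴) (y : 𝒴) :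
    inducedOutput p X Y (n + 1) f (Fin.snoc b y) = inducedOutput p X Y n f b *
      (pr p (fun ω => evA X Y f (extSeq b) (n + 1) n ω ∧ Y ω n = y) /
        pr p (evA X Y f (extSeq b) (n + 1) n)) := by
  rw [inducedOutput_eq, inducedOutput_eq, Finset.prod_range_succ]
  congr 1
  · apply Finset.prod_congr rfl
    intro i hi
    have hi := Finset.mem_range.1 hi
    congr 1 <;> apply pr_congr' <;> apply evA_congr <;> try omega
    · intro j hj; exact extSeq_snoc_lt _ _ _ (by omega)
    · intro j hj; exact extSeq_snoc_lt _ _ _ (by omega)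
  · congr 1
    · apply pr_congr'
      intro ω
      rw [← evA_congr X Y f le_rfl (extSeq_snoc_lt b y)]
      simp only [evA, Nat.lt_succ_iff_lt_or_eq, or_imp, forall_and, forall_eq, extSeq_snoc_eq]
      tauto
    · exact pr_congr' p (evA_congr X Y f le_rfl (extSeq_snoc_lt b y))

lemma evA_snoc [Nonempty 𝒴] (X : Ω → ℕ → 𝒳) (Y : Ω → ℕ → 𝒴) (n : ℕ)
    (f : (i : ℕ) → (Fin i → 𝒴) → 𝒳) (b : Fin n → 𝒴) (y : 𝒴) :
    evA X Y f (extSeq (Fin.snoc b y : Fin (n + 1) → 𝒴)) (n + 1) (n + 1) =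
      fun ω => evA X Y f (extSeq b) (n + 1) n ω ∧ Y ω n = y := by
  funext ω
  rw [eq_iff_iff, ← evA_congr X Y f le_rfl (extSeq_snoc_lt b y)]
  simp only [evA, Nat.lt_succ_iff_lt_or_eq, or_imp, forall_and, forall_eq, extSeq_snoc_eq]
  tauto

lemma inducedOutput_nonneg [Nonempty 𝒴] {p : Ω → ℝ} (hp0 : ∀ ω, 0 ≤ p ω) (X : Ω → ℕ → 𝒳)
    (Y : Ω → ℕ → 𝒴) (n : ℕ)
    (f : (i : ℕ) → (Fin i → 𝒴) → 𝒳) (b : Fin n → 𝒴) : 0 ≤ inducedOutput p X Y n f b :=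
  Finset.prod_nonneg fun _ _ => div_nonneg (pr_nonneg' hp0 _) (pr_nonneg' hp0 _)

lemma pr_pos_of_inducedOutput [Nonempty 𝒴] {p : Ω → ℝ} (hp0 : ∀ ω, 0 ≤ p ω)
    (hp1 : ∑ ω, p ω = 1) (X : Ω → ℕ → 𝒳)
    (Y : Ω → ℕ → 𝒴) (n : ℕ)
    (f : (i : ℕ) → (Fin i → 𝒴) → 𝒳) (b : Fin n → 𝒴) (h : inducedOutput p X Y n f b ≠ 0) :
    0 < pr p (evA X Y f (extSeq b) n n) := by
  refine lt_of_le_of_ne (pr_nonneg' hp0 _) (Ne.symm ?_)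
  cases n with
  | zero => simp [pr, evA, hp1]
  | succ n =>
    rw [inducedOutput_eq, Finset.prod_range_succ] at h
    intro h0
    rw [h0] at h
    simp at h

lemma main_strat [Fintype 𝒳] [Nonempty 𝒳] [Fintype 𝒴] [Nonempty 𝒴] {p : Ω → ℝ}
    (hp0 : ∀ ω, 0 ≤ p ω) (hp1 : ∑ ω, p ω = 1) (g : Ω → ℝ)
    (X : Ω → ℕ → 𝒳) (Y : Ω → ℕ → 𝒴) (n : ℕ) :
    ∃ f : (i : ℕ) → (Fin i → 𝒴) → 𝒳, compatible p X Y n f ∧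
      ∑ ω, p ω * g ω ≤ ∑ b : Fin n → 𝒴, inducedOutput p X Y n f b *
        (pr (fun ω => p ω * g ω) (evA X Y f (extSeq b) n n) /
          pr p (evA X Y f (extSeq b) n n)) := by
  obtain ⟨f, hf⟩ := exists_strat hp0 g X Y
  refine ⟨f, fun b i _ h => (hf b i h).1, ?_⟩
  induction n with
  | zero =>
    simp [inducedOutput, evA, pr, hp1]
  | succ n ih =>
    refine ih.trans ?_
    rw [← (Fin.snocEquiv (fun _ : Fin (n + 1) => 𝒴)).sum_comp, Fintype.sum_prod_type_right]
    apply Finset.sum_le_sum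
    intro b _
    have hstep : ∀ y, inducedOutput p X Y (n + 1) f (Fin.snoc b y) *
        (pr (fun ω => p ω * g ω)
            (evA X Y f (extSeq (Fin.snoc b y : Fin (n + 1) → 𝒴)) (n + 1) (n + 1)) /
          pr p (evA X Y f (extSeq (Fin.snoc b y : Fin (n + 1) → 𝒴)) (n + 1) (n + 1))) =
        inducedOutput p X Y n f b / pr p (evA X Y f (extSeq b) (n + 1) n) *
          pr (fun ω => p ω * g ω) (fun ω => evA X Y f (extSeq b) (n + 1) n ω ∧ Y ω n = y) := by
      intro y
      rw [inducedOutput_snoc, evA_snoc]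
      by_cases h0 : pr p (fun ω => evA X Y f (extSeq b) (n + 1) n ω ∧ Y ω n = y) = 0
      · rw [pr_mul_zero hp0 g h0, h0]; simp
      · field_simp
    have hs : ∑ y, inducedOutput p X Y (n + 1) f (Fin.snoc b y) *
        (pr (fun ω => p ω * g ω)
            (evA X Y f (extSeq (Fin.snoc b y : Fin (n + 1) → 𝒴)) (n + 1) (n + 1)) /
          pr p (evA X Y f (extSeq (Fin.snoc b y : Fin (n + 1) → 𝒴)) (n + 1) (n + 1))) =
        inducedOutput p X Y n f b * (pr (fun ω => p ω * g ω) (evA X Y f (extSeq b) (n + 1) n) /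
          pr p (evA X Y f (extSeq b) (n + 1) n)) := by
      rw [Finset.sum_congr rfl fun y _ => hstep y, ← Finset.mul_sum, sum_pr_split]
      ring
    refine le_trans ?_ hs.ge
    by_cases h0 : inducedOutput p X Y n f b = 0
    · simp [h0]
    · exact mul_le_mul_of_nonneg_left
        (hf _ n (pr_pos_of_inducedOutput hp0 hp1 X Y n f b h0)).2
        (inducedOutput_nonneg hp0 X Y n f b)

-- causally conditioned probability at a sample point
def causal (p : Ω → ℝ) (X : Ω → ℕ → 𝒳) (Y : Ω → ℕ → 𝒴) (n : ℕ) (ω : Ω) : ℝ :=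
  ∏ i ∈ Finset.range n,
    pr p (fun ω' => (∀ j < i + 1, X ω' j = X ω j) ∧ ∀ j < i + 1, Y ω' j = Y ω j) /
      pr p (fun ω' => (∀ j < i + 1, X ω' j = X ω j) ∧ ∀ j < i, Y ω' j = Y ω j)

lemma causal_eq [Nonempty 𝒴] (p : Ω → ℝ) (X : Ω → ℕ → 𝒳) (Y : Ω → ℕ → 𝒴) (n : ℕ)
    (f : (i : ℕ) → (Fin i → 𝒴) → 𝒳) (b : Fin n → 𝒴) (ω : Ω)
    (h : evA X Y f (extSeq b) n n ω) : causal p X Y n ω = inducedOutput p X Y n f b := by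
  unfold causal inducedOutput
  apply Finset.prod_congr rfl
  intro i hi
  have hi := Finset.mem_range.1 hi
  congr 1 <;> apply pr_congr' <;> intro ω' <;> refine and_congr ?_ ?_ <;>
    refine forall₂_congr fun j hj => ?_
  · rw [h.1 j (by omega)]
  · rw [h.2 j (by omega)]
  · rw [h.1 j (by omega)]
  · rw [h.2 j (by omega)]

lemma prefix_eq_iff {α : Type*} (X : Ω → ℕ → α) (i : ℕ) (ω ω' : Ω) :
    prefixSeq X i ω' = prefixSeq X i ω ↔ ∀ j < i, X ω' j = X ω j := by
  simp [prefixSeq, funext_iff, Fin.forall_iff]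

lemma info_density {p : Ω → ℝ} (hp0 : ∀ ω, 0 ≤ p ω) (hp1 : ∑ ω, p ω = 1)
    (X : Ω → ℕ → 𝒳) (Y : Ω → ℕ → 𝒴) (ω : Ω) (hω : 0 < p ω) (n : ℕ) :
    0 < causal p X Y n ω ∧
    ∑ i ∈ Finset.range n, Real.log
      ((pr p (fun ω' => prefixSeq X (i + 1) ω' = prefixSeq X (i + 1) ω ∧ Y ω' i = Y ω i ∧
            prefixSeq Y i ω' = prefixSeq Y i ω) *
          pr p (fun ω' => prefixSeq Y i ω' = prefixSeq Y i ω)) /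
        (pr p (fun ω' => prefixSeq X (i + 1) ω' = prefixSeq X (i + 1) ω ∧
            prefixSeq Y i ω' = prefixSeq Y i ω) *
          pr p (fun ω' => Y ω' i = Y ω i ∧ prefixSeq Y i ω' = prefixSeq Y i ω))) =
      Real.log (causal p X Y n ω) -
        Real.log (pr p (fun ω' => prefixSeq Y n ω' = prefixSeq Y n ω)) := by
  induction n with
  | zero =>
    have : pr p (fun ω' => prefixSeq Y 0 ω' = prefixSeq Y 0 ω) = 1 := by
      simp [prefix_eq_iff, pr, hp1]
    rw [this]
    simp [causal]
  | succ n ih =>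
    obtain ⟨hpos, ih⟩ := ih
    have hc : causal p X Y (n + 1) ω = causal p X Y n ω *
        (pr p (fun ω' => prefixSeq X (n + 1) ω' = prefixSeq X (n + 1) ω ∧ Y ω' n = Y ω n ∧
            prefixSeq Y n ω' = prefixSeq Y n ω) /
          pr p (fun ω' => prefixSeq X (n + 1) ω' = prefixSeq X (n + 1) ω ∧
            prefixSeq Y n ω' = prefixSeq Y n ω)) := by
      unfold causal
      rw [Finset.prod_range_succ]
      congr 2
      · apply pr_congr'
        intro ω'
        simp only [prefix_eq_iff, Nat.lt_succ_iff_lt_or_eq, or_imp, forall_and, forall_eq]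
        tauto
      · apply pr_congr'
        intro ω'
        simp only [prefix_eq_iff]
    have hy : pr p (fun ω' => prefixSeq Y (n + 1) ω' = prefixSeq Y (n + 1) ω) =
        pr p (fun ω' => Y ω' n = Y ω n ∧ prefixSeq Y n ω' = prefixSeq Y n ω) := by
      apply pr_congr'
      intro ω'
      simp only [prefix_eq_iff, Nat.lt_succ_iff_lt_or_eq, or_imp, forall_and, forall_eq]
      tauto
    rw [Finset.sum_range_succ, ih, hc, hy]
    have h1 : 0 < pr p (fun ω' => prefixSeq X (n + 1) ω' = prefixSeq X (n + 1) ω ∧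
        Y ω' n = Y ω n ∧ prefixSeq Y n ω' = prefixSeq Y n ω) :=
      pr_pos_of_mem hp0 hω ⟨rfl, rfl, rfl⟩
    have h2 : 0 < pr p (fun ω' => prefixSeq X (n + 1) ω' = prefixSeq X (n + 1) ω ∧
        prefixSeq Y n ω' = prefixSeq Y n ω) :=
      pr_pos_of_mem hp0 hω ⟨rfl, rfl⟩
    have h3 : 0 < pr p (fun ω' => Y ω' n = Y ω n ∧ prefixSeq Y n ω' = prefixSeq Y n ω) :=
      pr_pos_of_mem hp0 hω ⟨rfl, rfl⟩
    have h4 : 0 < pr p (fun ω' => prefixSeq Y n ω' = prefixSeq Y n ω) :=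
      pr_pos_of_mem hp0 hω rfl
    refine ⟨mul_pos hpos (div_pos h1 h2), ?_⟩
    rw [Real.log_div (mul_pos h1 h4).ne' (mul_pos h2 h3).ne', Real.log_mul h1.ne' h4.ne',
      Real.log_mul h2.ne' h3.ne', Real.log_mul hpos.ne' (div_pos h1 h2).ne',
      Real.log_div h1.ne' h2.ne']
    ring

lemma directedInfo_le [Fintype 𝒴] {p : Ω → ℝ} (hp0 : ∀ ω, 0 ≤ p ω) (hp1 : ∑ ω, p ω = 1)
    (X : Ω → ℕ → 𝒳) (Y : Ω → ℕ → 𝒴) (n : ℕ)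
    (T : (Fin n → 𝒴) → ℝ) (hT0 : ∀ b, 0 ≤ T b) (hT1 : ∑ b, T b = 1)
    (hac : ∀ ω, 0 < p ω → T (prefixSeq Y n ω) ≠ 0) :
    directedInfo p X Y n ≤
      ∑ ω, p ω * Real.log (causal p X Y n ω / T (prefixSeq Y n ω)) := by
  classical
  have h1 : directedInfo p X Y n = ∑ ω, p ω * (Real.log (causal p X Y n ω) -
      Real.log (pr p (fun ω' => prefixSeq Y n ω' = prefixSeq Y n ω))) := by
    unfold directedInfo condMutualInfo
    rw [Finset.sum_comm]
    apply Finset.sum_congr rfl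
    intro ω _
    rw [← Finset.mul_sum]
    rcases (hp0 ω).eq_or_lt with h | h
    · simp [← h]
    · rw [(info_density hp0 hp1 X Y ω h n).2]
  have h2 : ∀ ω, p ω * (Real.log (causal p X Y n ω) -
      Real.log (pr p (fun ω' => prefixSeq Y n ω' = prefixSeq Y n ω))) ≤
      p ω * Real.log (causal p X Y n ω / T (prefixSeq Y n ω)) +
      (p ω * (T (prefixSeq Y n ω) / pr p (fun ω' => prefixSeq Y n ω' = prefixSeq Y n ω))
        - p ω) := by
    intro ω
    rcases (hp0 ω).eq_or_lt with h | h
    · simp [← h]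
    · have hc := (info_density hp0 hp1 X Y ω h n).1
      have hT : 0 < T (prefixSeq Y n ω) := lt_of_le_of_ne (hT0 _) (hac ω h).symm
      have hP : 0 < pr p (fun ω' => prefixSeq Y n ω' = prefixSeq Y n ω) :=
        pr_pos_of_mem hp0 h rfl
      have hl := Real.log_le_sub_one_of_pos (div_pos hT hP)
      rw [Real.log_div hT.ne' hP.ne'] at hl
      rw [Real.log_div hc.ne' hT.ne']
      nlinarith [mul_le_mul_of_nonneg_left hl h.le]
  have h3 : ∑ ω, p ω * (T (prefixSeq Y n ω) /
      pr p (fun ω' => prefixSeq Y n ω' = prefixSeq Y n ω)) ≤ 1 := by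
    rw [← hT1]
    have : ∀ ω, p ω * (T (prefixSeq Y n ω) /
        pr p (fun ω' => prefixSeq Y n ω' = prefixSeq Y n ω)) =
        ∑ b, if prefixSeq Y n ω = b then
          p ω * (T b / pr p (fun ω' => prefixSeq Y n ω' = b)) else 0 := by
      intro ω
      simp
    rw [Finset.sum_congr rfl fun ω _ => this ω, Finset.sum_comm]
    apply Finset.sum_le_sum
    intro b _
    have : (∑ ω, if prefixSeq Y n ω = b then
          p ω * (T b / pr p (fun ω' => prefixSeq Y n ω' = b)) else 0) =
        pr p (fun ω' => prefixSeq Y n ω' = b) *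
          (T b / pr p (fun ω' => prefixSeq Y n ω' = b)) := by
      generalize T b / pr p (fun ω' => prefixSeq Y n ω' = b) = c
      rw [pr, Finset.sum_mul]
      apply Finset.sum_congr rfl
      intro ω _
      split_ifs <;> simp
    rw [this]
    by_cases h0 : pr p (fun ω' => prefixSeq Y n ω' = b) = 0
    · simp [h0, hT0 b]
    · rw [mul_div_cancel₀ _ h0]
  rw [h1]
  refine (Finset.sum_le_sum fun ω _ => h2 ω).trans ?_
  rw [Finset.sum_add_distrib, Finset.sum_sub_distrib, hp1]
  linarith

lemma prefix_of_evA [Nonempty 𝒴] (X : Ω → ℕ → 𝒳) (Y : Ω → ℕ → 𝒴) (n : ℕ)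
    (f : (i : ℕ) → (Fin i → 𝒴) → 𝒳) (b : Fin n → 𝒴) (ω : Ω)
    (h : evA X Y f (extSeq b) n n ω) : prefixSeq Y n ω = b := by
  funext j
  have := h.2 j j.2
  simpa [extSeq, prefixSeq] using this

end aux

/-- dual capacity upper bound for directed information:
`I(X^n→Y^n) ≤ max_{f compatible} D(P^f_{Y^n} ‖ T)` for any test distribution `T`. -/
theorem dual_capacity_upper_bound
    {Ω 𝒳 𝒴 : Type*} [Fintype Ω] [Fintype 𝒳] [Fintype 𝒴] [Nonempty 𝒴]
    (p : Ω → ℝ) (hp0 : ∀ ω, 0 ≤ p ω) (hp1 : ∑ ω, p ω = 1)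
    (X : Ω → ℕ → 𝒳) (Y : Ω → ℕ → 𝒴) (n : ℕ)
    (T : (Fin n → 𝒴) → ℝ) (hT0 : ∀ b, 0 ≤ T b) (hT1 : ∑ b, T b = 1) :
    (directedInfo p X Y n : EReal) ≤
      ⨆ f : {f : (i : ℕ) → (Fin i → 𝒴) → 𝒳 // compatible p X Y n f},
        klDivFin (inducedOutput p X Y n f.1) T := by
  classical
  have hΩ : Nonempty Ω := by
    by_contra hne
    rw [not_nonempty_iff] at hne
    simp at hp1
  have hX : Nonempty 𝒳 := ⟨X hΩ.some 0⟩
  by_cases hac : ∀ ω, 0 < p ω → T (prefixSeq Y n ω) ≠ 0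
  · obtain ⟨f, hf, hle⟩ := main_strat hp0 hp1
      (fun ω => Real.log (causal p X Y n ω / T (prefixSeq Y n ω))) X Y n
    refine le_trans ?_ (le_iSup _ (⟨f, hf⟩ :
      {f : (i : ℕ) → (Fin i → 𝒴) → 𝒳 // compatible p X Y n f}))
    unfold klDivFin
    split_ifs
    · rw [EReal.coe_le_coe_iff]
      refine ((directedInfo_le hp0 hp1 X Y n T hT0 hT1 hac).trans hle).trans (le_of_eq ?_)
      apply Finset.sum_congr rfl
      intro b _
      by_cases h0 : inducedOutput p X Y n f b = 0
      · simp [h0]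
      · have hpos := pr_pos_of_inducedOutput hp0 hp1 X Y n f b h0
        rw [pr_mul_const p _ _ (Real.log (inducedOutput p X Y n f b / T b)),
          mul_div_cancel_left₀ _ hpos.ne']
        intro ω hω
        rw [causal_eq p X Y n f b ω hω, prefix_of_evA X Y n f b ω hω]
    · exact le_top
  · push Not at hac
    obtain ⟨ω₀, hω₀, hT⟩ := hac
    obtain ⟨f, hf, hle⟩ := main_strat hp0 hp1
      (fun ω => if T (prefixSeq Y n ω) = 0 then 1 else 0) X Y n
    refine le_trans ?_ (le_iSup _ (⟨f, hf⟩ :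
      {f : (i : ℕ) → (Fin i → 𝒴) → 𝒳 // compatible p X Y n f}))
    unfold klDivFin
    rw [if_neg]
    · exact le_top
    · intro hall
      have hz : ∑ b : Fin n → 𝒴, inducedOutput p X Y n f b *
        (pr (fun ω => p ω * (if T (prefixSeq Y n ω) = 0 then 1 else 0))
          (evA X Y f (extSeq b) n n) / pr p (evA X Y f (extSeq b) n n)) = 0 := by
        apply Finset.sum_eq_zero
        intro b _
        by_cases hb : T b = 0
        · rw [hall b hb, zero_mul]
        · rw [pr_mul_const p _ _ 0]
          · simp
          · intro ω hω
            rw [prefix_of_evA X Y n f b ω hω, if_neg hb]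
      rw [hz] at hle
      have : 0 < ∑ ω, p ω * (if T (prefixSeq Y n ω) = 0 then (1 : ℝ) else 0) := by
        apply Finset.sum_pos'
        · intro ω _
          exact mul_nonneg (hp0 ω) (by split_ifs <;> norm_num)
        · exact ⟨ω₀, Finset.mem_univ _, by simpa [hT] using hω₀⟩
      linarith
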